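/- Let (Q,R) be a gentle presentation and let m ≥ 2. An element u of Γ_m∥B is a cocycle of the complex k(Γ∥B) and not a coboundary if and only if one of the following holds: (i) m is even or char(k) = 2, and there is a loop b with u = (b^m, s(b)); (ii) m is odd or char(k) = 2, and there is a complete cycle C with first arrow b such that u = (bC, b); (iii) u = (γ,α) with γ a Γ-maximal element of Γ_m and γ and α neither starting nor ending with the same arrow. -/

import Mathlib

/-!
Common framework: quivers, paths (as a start vertex together with a list of
composable arrows, listed in order of traversal, so that the paper's path
`c_m ⋯ c_1` corresponds to the list `[c_1, …, c_m]`), gentle and quadratic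
monomial presentations, the cochain complex `k(Γ ∥ B)` and the chain complex
`k(B ⊙ Γ)` of the paper.
-/

namespace GentleTT

structure Quiv where
  V : Type
  A : Type
  [fintV : Fintype V]
  [fintA : Fintype A]
  [decV : DecidableEq V]
  [decA : DecidableEq A]
  src : A → V
  tgt : A → V

attribute [instance] Quiv.fintV Quiv.fintA Quiv.decV Quiv.decA

/-- A "path datum": a start vertex together with the list of arrows traversed. -/
abbrev PathDat (Q : Quiv) := Q.V × List Q.A

def psrc (Q : Quiv) (p : PathDat Q) : Q.V := p.1

def ptgt (Q : Quiv) (p : PathDat Q) : Q.V := p.2.getLast?.elim p.1 Q.tgt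

def plen (Q : Quiv) (p : PathDat Q) : ℕ := p.2.length

/-- `p` is a genuine path: consecutive arrows compose, and the recorded start
vertex is the source of the first arrow (if any). -/
def Ok (Q : Quiv) (p : PathDat Q) : Prop :=
  p.2.Chain' (fun a b => Q.tgt a = Q.src b) ∧ ∀ a ∈ p.2.head?, Q.src a = p.1

/-- `p` is a path none of whose length-2 subpaths lies in `R`
(an element of the basis `B` of `kQ/⟨R⟩`). -/
def InB (Q : Quiv) (R : Set (Q.A × Q.A)) (p : PathDat Q) : Prop :=
  Ok Q p ∧ p.2.Chain' (fun a b => (a, b) ∉ R)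

/-- `p` is a path all of whose length-2 subpaths lie in `R` (an element of `Γ`). -/
def InG (Q : Quiv) (R : Set (Q.A × Q.A)) (p : PathDat Q) : Prop :=
  Ok Q p ∧ p.2.Chain' (fun a b => (a, b) ∈ R)

/-- Parallel paths: same source and same target. -/
def Par (Q : Quiv) (p q : PathDat Q) : Prop :=
  psrc Q p = psrc Q q ∧ ptgt Q p = ptgt Q q

/-- Antiparallel paths: `s(p) = t(q)` and `t(p) = s(q)`. -/
def AntiPar (Q : Quiv) (p q : PathDat Q) : Prop :=
  psrc Q p = ptgt Q q ∧ ptgt Q p = psrc Q q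

/-- A cycle: a path of positive length whose source equals its target. -/
def IsCycle (Q : Quiv) (p : PathDat Q) : Prop :=
  Ok Q p ∧ p.2 ≠ [] ∧ psrc Q p = ptgt Q p

/-- Rotation of a cycle: the paper's `rot (c_m ⋯ c_1) = c_{m-1} ⋯ c_1 c_m`
(the last arrow traversed becomes the first one traversed). -/
def rotP (Q : Quiv) (p : PathDat Q) : PathDat Q :=
  match p.2.getLast? with
  | none => p
  | some a => (Q.src a, a :: p.2.dropLast)

/-- Iterated rotation `rot^i`. -/
def rotI (Q : Quiv) (i : ℕ) (p : PathDat Q) : PathDat Q := (rotP Q)^[i] p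

def powL {α : Type} (l : List α) : ℕ → List α
  | 0 => []
  | n + 1 => l ++ powL l n

/-- The `n`-th power `p^n` of a (cyclic) path. -/
def powP (Q : Quiv) (p : PathDat Q) (n : ℕ) : PathDat Q := (p.1, powL p.2 n)

/-- A primitive cycle: a cycle that is not a proper power of another cycle. -/
def IsPrimitive (Q : Quiv) (p : PathDat Q) : Prop :=
  IsCycle Q p ∧ ∀ (q : PathDat Q) (n : ℕ), IsCycle Q q → 2 ≤ n → p ≠ powP Q q n

/-- The period of a cycle: the least `i ≥ 1` with `rot^i p = p`. -/
noncomputable def periodP (Q : Quiv) (p : PathDat Q) : ℕ :=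
  sInf {i : ℕ | 1 ≤ i ∧ rotI Q i p = p}

/-- Two cycles are conjugate (belong to the same circuit) if one is obtained
from the other by iterated rotation. -/
def RotEquiv (Q : Quiv) (p q : PathDat Q) : Prop := ∃ i : ℕ, rotI Q i p = q

/-- A cocomplete cycle: `p² ∈ B`. -/
def Cocomplete (Q : Quiv) (R : Set (Q.A × Q.A)) (p : PathDat Q) : Prop :=
  IsCycle Q p ∧ InB Q R (powP Q p 2)

/-- A complete cycle: `p² ∈ Γ`. -/
def Complete (Q : Quiv) (R : Set (Q.A × Q.A)) (p : PathDat Q) : Prop :=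
  IsCycle Q p ∧ InG Q R (powP Q p 2)

/-- `B`-maximal path: in `B` and not a proper subpath of another element of `B`. -/
def BMax (Q : Quiv) (R : Set (Q.A × Q.A)) (p : PathDat Q) : Prop :=
  InB Q R p ∧ ∀ q : PathDat Q, InB Q R q → p.2 <:+: q.2 → p.2 = q.2

/-- `Γ`-maximal path: in `Γ` and not a proper subpath of another element of `Γ`. -/
def GMax (Q : Quiv) (R : Set (Q.A × Q.A)) (p : PathDat Q) : Prop :=
  InG Q R p ∧ ∀ q : PathDat Q, InG Q R q → p.2 <:+: q.2 → p.2 = q.2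

def Adj (Q : Quiv) (v w : Q.V) : Prop :=
  ∃ a : Q.A, (Q.src a = v ∧ Q.tgt a = w) ∨ (Q.src a = w ∧ Q.tgt a = v)

/-- Connectedness of the underlying graph of the quiver. -/
def Connected (Q : Quiv) : Prop := ∀ v w : Q.V, Relation.ReflTransGen (Adj Q) v w

/-- A quadratic monomial presentation: the relations are paths of length 2. -/
def IsQuadMon (Q : Quiv) (R : Set (Q.A × Q.A)) : Prop :=
  ∀ r ∈ R, Q.tgt r.1 = Q.src r.2

/-- A gentle presentation. -/
structure IsGentle (Q : Quiv) (R : Set (Q.A × Q.A)) : Prop where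
  nonempty : Nonempty Q.V
  connected : Connected Q
  relComposable : ∀ r ∈ R, Q.tgt r.1 = Q.src r.2
  srcLe : ∀ v : Q.V, {a : Q.A | Q.src a = v}.ncard ≤ 2
  tgtLe : ∀ v : Q.V, {a : Q.A | Q.tgt a = v}.ncard ≤ 2
  uniqNotRelAfter : ∀ a : Q.A, {b : Q.A | Q.tgt a = Q.src b ∧ (a, b) ∉ R}.Subsingleton
  uniqNotRelBefore : ∀ a : Q.A, {c : Q.A | Q.tgt c = Q.src a ∧ (c, a) ∉ R}.Subsingleton
  uniqRelAfter : ∀ a : Q.A, {b : Q.A | Q.tgt a = Q.src b ∧ (a, b) ∈ R}.Subsingleton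
  uniqRelBefore : ∀ a : Q.A, {c : Q.A | Q.tgt c = Q.src a ∧ (c, a) ∈ R}.Subsingleton

/-- A spanning tree of the (finite, connected) quiver `Q`: a set of arrows
which connects all vertices and has exactly `|Q₀| - 1` elements. -/
def IsSpanningTree (Q : Quiv) (T : Set Q.A) : Prop :=
  (∀ v w : Q.V, Relation.ReflTransGen
      (fun x y => ∃ a ∈ T, (Q.src a = x ∧ Q.tgt a = y) ∨ (Q.src a = y ∧ Q.tgt a = x)) v w) ∧
  T.ncard + 1 = Fintype.card Q.V

/-- A set of representatives, one for each rotation class of cycles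
satisfying `Pred`. -/
def IsRepSet (Q : Quiv) (P : Set (PathDat Q)) (Pred : PathDat Q → Prop) : Prop :=
  (∀ p ∈ P, Pred p) ∧ ∀ q : PathDat Q, Pred q → ∃! p, p ∈ P ∧ RotEquiv Q q p

/-- `S` is a valid choice of the paper's set `Crep` for the predicate `Pred`
(e.g. cocompleteness, or completeness): it consists of all positive powers of a
chosen set of representatives of the rotation classes of primitive cycles
satisfying `Pred`. -/
def IsCrep (Q : Quiv) (S : Set (PathDat Q)) (Pred : PathDat Q → Prop) : Prop :=
  ∃ P : Set (PathDat Q),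
    IsRepSet Q P (fun p => IsPrimitive Q p ∧ Pred p) ∧
    S = {x | ∃ p ∈ P, ∃ n : ℕ, 1 ≤ n ∧ x = powP Q p n}

/-! ### The cochain complex `k(Γ ∥ B)` -/

/-- Membership in the degree-`m` basis `Γ_m ∥ B` of the cochain complex. -/
def GBmem (Q : Quiv) (R : Set (Q.A × Q.A)) (m : ℕ) (x : PathDat Q × PathDat Q) : Prop :=
  InG Q R x.1 ∧ plen Q x.1 = m ∧ InB Q R x.2 ∧ Par Q x.1 x.2

abbrev GB (Q : Quiv) (R : Set (Q.A × Q.A)) (m : ℕ) :=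
  {x : PathDat Q × PathDat Q // GBmem Q R m x}

/-- The degree-`m` component of the cochain complex `k(Γ ∥ B)`. -/
abbrev Coch (k : Type) [Field k] (Q : Quiv) (R : Set (Q.A × Q.A)) (m : ℕ) :=
  GB Q R m →₀ k

/-- The basis vector of `k(Γ_m ∥ B)` attached to a raw pair of path data
(and `0` if the pair is not in `Γ_m ∥ B`). -/
noncomputable def bv (k : Type) [Field k] (Q : Quiv) (R : Set (Q.A × Q.A)) (m : ℕ)
    (x : PathDat Q × PathDat Q) : Coch k Q R m := by
  classical
  exact if h : GBmem Q R m x then Finsupp.single (⟨x, h⟩ : GB Q R m) (1 : k) else 0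

/-- Extension on the left (in the paper's notation): `p ↦ b p`. -/
def extL (Q : Quiv) (b : Q.A) (p : PathDat Q) : PathDat Q := (p.1, p.2 ++ [b])

/-- Extension on the right (in the paper's notation): `p ↦ p a`. -/
def extR (Q : Quiv) (a : Q.A) (p : PathDat Q) : PathDat Q := (Q.src a, a :: p.2)

/-- The differential on a basis element:
`d^m (γ, α) = Σ_b (bγ, bα) - (-1)^m Σ_a (γa, αa)`. -/
noncomputable def dB (k : Type) [Field k] (Q : Quiv) (R : Set (Q.A × Q.A)) (m : ℕ)
    (x : GB Q R m) : Coch k Q R (m + 1) := by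
  classical
  exact
    (∑ b : Q.A,
      if h : GBmem Q R (m + 1) (extL Q b x.val.1, extL Q b x.val.2) then
        Finsupp.single (⟨_, h⟩ : GB Q R (m + 1)) (1 : k) else 0)
    - ((-1 : k) ^ m) •
      (∑ a : Q.A,
        if h : Q.tgt a = psrc Q x.val.1 ∧
            GBmem Q R (m + 1) (extR Q a x.val.1, extR Q a x.val.2) then
          Finsupp.single (⟨_, h.2⟩ : GB Q R (m + 1)) (1 : k) else 0)

/-- The differential `d^m : k(Γ_m ∥ B) → k(Γ_{m+1} ∥ B)`. -/
noncomputable def dLin (k : Type) [Field k] (Q : Quiv) (R : Set (Q.A × Q.A)) (m : ℕ) :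
    Coch k Q R m →ₗ[k] Coch k Q R (m + 1) :=
  Finsupp.linearCombination k (dB k Q R m)

/-- The element `𝟙 = Σ_{i ∈ Q₀} (e_i, e_i)` (placed in degree `m`; it is the
intended element when `m = 0`). -/
noncomputable def oneD (k : Type) [Field k] (Q : Quiv) (R : Set (Q.A × Q.A)) (m : ℕ) :
    Coch k Q R m :=
  ∑ i : Q.V, bv k Q R m ((i, []), (i, []))

/-- `⟨α⟩ = Σ_{i=0}^{r-1} (s(rot^i α), rot^i α)`, `r` the period of `α`. -/
noncomputable def cycB (k : Type) [Field k] (Q : Quiv) (R : Set (Q.A × Q.A)) (m : ℕ)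
    (α : PathDat Q) : Coch k Q R m :=
  ∑ i ∈ Finset.range (periodP Q α),
    bv k Q R m ((psrc Q (rotI Q i α), []), rotI Q i α)

/-- `⟨C⟩ = Σ_{i=0}^{r-1} (-1)^{i m} (rot^i C, s(rot^i C))`, `r` the period of `C`. -/
noncomputable def cycG (k : Type) [Field k] (Q : Quiv) (R : Set (Q.A × Q.A)) (m : ℕ)
    (C : PathDat Q) : Coch k Q R m :=
  ∑ i ∈ Finset.range (periodP Q C),
    ((-1 : k) ^ (i * m)) • bv k Q R m (rotI Q i C, (psrc Q (rotI Q i C), []))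

/-- The coboundary subspace in degree `m` (zero in degree `0`). -/
noncomputable def cobSp (k : Type) [Field k] (Q : Quiv) (R : Set (Q.A × Q.A)) :
    (m : ℕ) → Submodule k (Coch k Q R m)
  | 0 => ⊥
  | m + 1 => LinearMap.range (dLin k Q R m)

/-- The cocycle subspace in degree `m`. -/
noncomputable def cocSp (k : Type) [Field k] (Q : Quiv) (R : Set (Q.A × Q.A)) (m : ℕ) :
    Submodule k (Coch k Q R m) :=
  LinearMap.ker (dLin k Q R m)

/-- The degree-`m` cohomology `HH^m` of the complex `k(Γ ∥ B)` vanishes: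
every cocycle is a coboundary. -/
def CohomIsZero (k : Type) [Field k] (Q : Quiv) (R : Set (Q.A × Q.A)) (m : ℕ) : Prop :=
  cocSp k Q R m ≤ cobSp k Q R m

/-- The degree-`m` cohomology `HH^m` of the complex `k(Γ ∥ B)` is
finite-dimensional: there is a finite set of cocycles whose classes span it. -/
def CohomFinDim (k : Type) [Field k] (Q : Quiv) (R : Set (Q.A × Q.A)) (m : ℕ) : Prop :=
  ∃ G : Finset (Coch k Q R m), ↑G ⊆ (cocSp k Q R m : Set (Coch k Q R m)) ∧
    cocSp k Q R m ≤ cobSp k Q R m ⊔ Submodule.span k ↑G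

/-- The degree-`m` cohomology `HH^m` of the complex `k(Γ ∥ B)` has dimension at
most `n`: there are `n` cocycles whose classes span it. -/
def CohomDimLe (k : Type) [Field k] (Q : Quiv) (R : Set (Q.A × Q.A)) (m n : ℕ) : Prop :=
  ∃ G : Finset (Coch k Q R m), G.card ≤ n ∧
    ↑G ⊆ (cocSp k Q R m : Set (Coch k Q R m)) ∧
    cocSp k Q R m ≤ cobSp k Q R m ⊔ Submodule.span k ↑G

/-- `Gen` is a basis of the kernel of `d⁰`, i.e. it freely generates `HH⁰`. -/
def FreelyGeneratesKer0 (k : Type) [Field k] (Q : Quiv) (R : Set (Q.A × Q.A))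
    (Gen : Set (Coch k Q R 0)) : Prop :=
  (∀ x ∈ Gen, dLin k Q R 0 x = 0) ∧
  (∀ z : Coch k Q R 0, dLin k Q R 0 z = 0 → z ∈ Submodule.span k Gen) ∧
  LinearIndependent k (fun x : Gen => (x : Coch k Q R 0))

/-- The cohomology classes of the elements of `Gen` freely generate the
degree-`(m+1)` cohomology of `k(Γ ∥ B)`: all elements of `Gen` are cocycles,
every cocycle is congruent to an element of their span modulo coboundaries, no
nonzero element of their span is a coboundary, and `Gen` is linearly
independent. -/
def FreelyGeneratesCohom (k : Type) [Field k] (Q : Quiv) (R : Set (Q.A × Q.A)) (m : ℕ)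
    (Gen : Set (Coch k Q R (m + 1))) : Prop :=
  (∀ x ∈ Gen, dLin k Q R (m + 1) x = 0) ∧
  (∀ z : Coch k Q R (m + 1), dLin k Q R (m + 1) z = 0 →
      ∃ y : Coch k Q R m, z - dLin k Q R m y ∈ Submodule.span k Gen) ∧
  (∀ x ∈ Submodule.span k Gen, x ∈ LinearMap.range (dLin k Q R m) → x = 0) ∧
  LinearIndependent k (fun x : Gen => (x : Coch k Q R (m + 1)))

/-! ### The chain complex `k(B ⊙ Γ)` -/

/-- Membership in the degree-`m` basis `B ⊙ Γ_m` of the chain complex. -/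
def BGmem (Q : Quiv) (R : Set (Q.A × Q.A)) (m : ℕ) (x : PathDat Q × PathDat Q) : Prop :=
  InB Q R x.1 ∧ InG Q R x.2 ∧ plen Q x.2 = m ∧ AntiPar Q x.1 x.2

abbrev BGt (Q : Quiv) (R : Set (Q.A × Q.A)) (m : ℕ) :=
  {x : PathDat Q × PathDat Q // BGmem Q R m x}

/-- The degree-`m` component of the chain complex `k(B ⊙ Γ)`. -/
abbrev Chn (k : Type) [Field k] (Q : Quiv) (R : Set (Q.A × Q.A)) (m : ℕ) :=
  BGt Q R m →₀ k

/-- The basis vector of `k(B ⊙ Γ_m)` attached to a raw pair of path data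
(and `0` if the pair is not in `B ⊙ Γ_m`). -/
noncomputable def bw (k : Type) [Field k] (Q : Quiv) (R : Set (Q.A × Q.A)) (m : ℕ)
    (x : PathDat Q × PathDat Q) : Chn k Q R m := by
  classical
  exact if h : BGmem Q R m x then Finsupp.single (⟨x, h⟩ : BGt Q R m) (1 : k) else 0

/-- `l1(p)`: the last arrow of `p` (as a path of length one). -/
def l1P (Q : Quiv) (p : PathDat Q) : PathDat Q :=
  match p.2.getLast? with
  | none => p
  | some a => (Q.src a, [a])

/-- `l2(p)`: `p` with its last arrow removed. -/
def l2P (Q : Quiv) (p : PathDat Q) : PathDat Q := (p.1, p.2.dropLast)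

/-- `r1(p)`: `p` with its first arrow removed. -/
def r1P (Q : Quiv) (p : PathDat Q) : PathDat Q :=
  match p.2 with
  | [] => p
  | a :: l => (Q.tgt a, l)

/-- `r2(p)`: the first arrow of `p` (as a path of length one). -/
def r2P (Q : Quiv) (p : PathDat Q) : PathDat Q :=
  match p.2 with
  | [] => p
  | a :: _ => (Q.src a, [a])

/-- The raw first term `(α·l1(γ), l2(γ))` of the boundary of `(α, γ)`. -/
def d1raw (Q : Quiv) (x : PathDat Q × PathDat Q) : PathDat Q × PathDat Q :=
  match x.2.2.getLast? with
  | none => x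
  | some a => ((Q.src a, a :: x.1.2), (x.2.1, x.2.2.dropLast))

/-- The raw second term `(r2(γ)·α, r1(γ))` of the boundary of `(α, γ)`. -/
def d2raw (Q : Quiv) (x : PathDat Q × PathDat Q) : PathDat Q × PathDat Q :=
  match x.2.2 with
  | [] => x
  | c :: l => ((x.1.1, x.1.2 ++ [c]), (Q.tgt c, l))

/-- The boundary of a basis element:
`d_m (α, γ) = (α·l1(γ), l2(γ)) + (-1)^m (r2(γ)·α, r1(γ))` (in degree `m = m+1`),
where pairs whose first component is not in `B` are interpreted as `0`. -/
noncomputable def bdB (k : Type) [Field k] (Q : Quiv) (R : Set (Q.A × Q.A)) (m : ℕ)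
    (x : BGt Q R (m + 1)) : Chn k Q R m :=
  bw k Q R m (d1raw Q x.val) + ((-1 : k) ^ (m + 1)) • bw k Q R m (d2raw Q x.val)

/-- The boundary map `d_{m+1} : k(B ⊙ Γ_{m+1}) → k(B ⊙ Γ_m)`. -/
noncomputable def bd (k : Type) [Field k] (Q : Quiv) (R : Set (Q.A × Q.A)) (m : ℕ) :
    Chn k Q R (m + 1) →ₗ[k] Chn k Q R m :=
  Finsupp.linearCombination k (bdB k Q R m)

/-- The subspace of cycles in degree `m` (everything in degree `0`). -/
noncomputable def ZSp (k : Type) [Field k] (Q : Quiv) (R : Set (Q.A × Q.A)) :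
    (m : ℕ) → Submodule k (Chn k Q R m)
  | 0 => ⊤
  | m + 1 => LinearMap.ker (bd k Q R m)

/-- The subspace of boundaries in degree `m`. -/
noncomputable def BSp (k : Type) [Field k] (Q : Quiv) (R : Set (Q.A × Q.A)) (m : ℕ) :
    Submodule k (Chn k Q R m) :=
  LinearMap.range (bd k Q R m)

/-- The degree-`m` homology `HH_m` of the complex `k(B ⊙ Γ)` vanishes:
every cycle is a boundary. -/
def HomIsZero (k : Type) [Field k] (Q : Quiv) (R : Set (Q.A × Q.A)) (m : ℕ) : Prop :=
  ZSp k Q R m ≤ BSp k Q R m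

/-- The degree-`m` homology `HH_m` of the complex `k(B ⊙ Γ)` is
finite-dimensional: there is a finite set of cycles whose classes span it. -/
def HomFinDim (k : Type) [Field k] (Q : Quiv) (R : Set (Q.A × Q.A)) (m : ℕ) : Prop :=
  ∃ G : Finset (Chn k Q R m), ↑G ⊆ (ZSp k Q R m : Set (Chn k Q R m)) ∧
    ZSp k Q R m ≤ BSp k Q R m ⊔ Submodule.span k ↑G

/-- The concatenation `α γ` of an antiparallel pair (a cycle, or a trivial path). -/
def concatP (Q : Quiv) (x : PathDat Q × PathDat Q) : PathDat Q := (x.2.1, x.2.2 ++ x.1.2)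

/-- The degree-`m` component of the subcomplex `k(B ⊙ Γ)_C`, spanned by the
basis elements whose concatenation lies in the circuit (rotation class) of `c`. -/
noncomputable def Wsp (k : Type) [Field k] (Q : Quiv) (R : Set (Q.A × Q.A))
    (c : PathDat Q) (m : ℕ) : Submodule k (Chn k Q R m) :=
  Submodule.span k {z : Chn k Q R m |
    ∃ x : BGt Q R m, RotEquiv Q (concatP Q x.val) c ∧ z = Finsupp.single x (1 : k)}

/-- The boundaries of the subcomplex `k(B ⊙ Γ)_C` in degree `m`. -/
noncomputable def WB (k : Type) [Field k] (Q : Quiv) (R : Set (Q.A × Q.A))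
    (c : PathDat Q) (m : ℕ) : Submodule k (Chn k Q R m) :=
  Submodule.map (bd k Q R m) (Wsp k Q R c (m + 1))

/-- The cycles of the subcomplex `k(B ⊙ Γ)_C` in degree `m`. -/
noncomputable def WZ (k : Type) [Field k] (Q : Quiv) (R : Set (Q.A × Q.A))
    (c : PathDat Q) (m : ℕ) : Submodule k (Chn k Q R m) :=
  ZSp k Q R m ⊓ Wsp k Q R c m

/-- The degree-`m` homology of `k(B ⊙ Γ)_C` is one-dimensional, spanned by the
homology class of `v`. -/
def SubHomSpannedBy (k : Type) [Field k] (Q : Quiv) (R : Set (Q.A × Q.A))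
    (c : PathDat Q) (m : ℕ) (v : Chn k Q R m) : Prop :=
  v ∈ WZ k Q R c m ∧ v ∉ WB k Q R c m ∧
  ∀ z ∈ WZ k Q R c m, ∃ t : k, z - t • v ∈ WB k Q R c m

/-- `ĥ(c) = Σ_{i=0}^{r-1} (r1(rot^i c), r2(rot^i c))` (degree 1, for cocomplete cycles;
placed in degree `m`). -/
noncomputable def hCycR (k : Type) [Field k] (Q : Quiv) (R : Set (Q.A × Q.A)) (m : ℕ)
    (c : PathDat Q) : Chn k Q R m :=
  ∑ i ∈ Finset.range (periodP Q c),
    bw k Q R m (r1P Q (rotI Q i c), r2P Q (rotI Q i c))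

/-- `ĥ(c) = Σ_{i=0}^{r-1} (-1)^{(m+1) i} (s(rot^i c), rot^i c)` (degree `m`, for
complete cycles of length `m`). -/
noncomputable def hCycM (k : Type) [Field k] (Q : Quiv) (R : Set (Q.A × Q.A)) (m : ℕ)
    (c : PathDat Q) : Chn k Q R m :=
  ∑ i ∈ Finset.range (periodP Q c),
    ((-1 : k) ^ ((m + 1) * i)) • bw k Q R m ((psrc Q (rotI Q i c), []), rotI Q i c)

/-- The homology classes of the elements of `Gen` freely generate the degree-`m`
homology of `k(B ⊙ Γ)`. -/
def FreelyGeneratesHom (k : Type) [Field k] (Q : Quiv) (R : Set (Q.A × Q.A)) (m : ℕ)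
    (Gen : Set (Chn k Q R m)) : Prop :=
  (∀ x ∈ Gen, x ∈ ZSp k Q R m) ∧
  (∀ z ∈ ZSp k Q R m, ∃ y : Chn k Q R (m + 1), z - bd k Q R m y ∈ Submodule.span k Gen) ∧
  (∀ x ∈ Submodule.span k Gen, x ∈ LinearMap.range (bd k Q R m) → x = 0) ∧
  LinearIndependent k (fun x : Gen => (x : Chn k Q R m))

/-! ### Structural lemmas -/

theorem gb_iff (Q : Quiv) (R : Set (Q.A × Q.A)) (m : ℕ) (v w : Q.V) (l l' : List Q.A) :
    GBmem Q R m ((v, l), (w, l')) ↔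
      ((l.IsChain (fun a b => Q.tgt a = Q.src b) ∧ ∀ a ∈ l.head?, Q.src a = v) ∧
        l.IsChain (fun a b => (a, b) ∈ R)) ∧ l.length = m ∧
      ((l'.IsChain (fun a b => Q.tgt a = Q.src b) ∧ ∀ a ∈ l'.head?, Q.src a = w) ∧
        l'.IsChain (fun a b => (a, b) ∉ R)) ∧ v = w ∧
        l.getLast?.elim v Q.tgt = l'.getLast?.elim w Q.tgt := Iff.rfl

theorem extL_iff {Q : Quiv} {R : Set (Q.A × Q.A)} (hg : IsGentle Q R) {m : ℕ} {v w : Q.V}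
    {l l' : List Q.A} (h : GBmem Q R m ((v, l), (w, l'))) {c : Q.A} (hc : l.getLast? = some c)
    (b : Q.A) :
    GBmem Q R (m + 1) (extL Q b (v, l), extL Q b (w, l')) ↔
      (c, b) ∈ R ∧ ∀ d ∈ l'.getLast?, (d, b) ∉ R := by
  have hne : l ≠ [] := by rintro rfl; simp at hc
  have hco := hg.relComposable (c, b)
  simp only [extL, gb_iff, List.isChain_append, List.isChain_singleton] at h ⊢
  obtain ⟨⟨⟨h1, h2⟩, h3⟩, h4, ⟨⟨h5, h6⟩, h7⟩, h8, h9⟩ := h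
  constructor
  · rintro ⟨⟨-, h⟩, -, ⟨-, h'⟩, -⟩
    exact ⟨h.2.2 c hc b rfl, fun d hd => h'.2.2 d hd b rfl⟩
  · rintro ⟨h, h'⟩
    have hh := hco h
    simp only at hh
    rw [hc] at h9
    simp only [Option.elim_some] at h9
    refine ⟨⟨⟨⟨h1, trivial, ?_⟩, ?_⟩, h3, trivial, ?_⟩, by simp [h4],
      ⟨⟨⟨h5, trivial, ?_⟩, ?_⟩, h7, trivial, ?_⟩, h8, by simp⟩
    · intro x hx y hy; simp_all
    · intro a ha; apply h2; cases l <;> simp_all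
    · intro x hx y hy; simp_all
    · intro x hx y hy
      simp only [Option.mem_def] at hx
      rw [hx] at h9
      simp_all
    · intro a ha; cases l' with
      | nil => simp_all
      | cons => apply h6; simp_all
    · intro x hx y hy; simp_all

theorem extR_iff {Q : Quiv} {R : Set (Q.A × Q.A)} (hg : IsGentle Q R) {m : ℕ} {v w : Q.V}
    {l l' : List Q.A} (h : GBmem Q R m ((v, l), (w, l'))) {c : Q.A} (hc : l.head? = some c)
    (a : Q.A) :
    (Q.tgt a = v ∧ GBmem Q R (m + 1) (extR Q a (v, l), extR Q a (w, l'))) ↔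
      (a, c) ∈ R ∧ ∀ d ∈ l'.head?, (a, d) ∉ R := by
  have hne : l ≠ [] := by rintro rfl; simp at hc
  have hco := hg.relComposable (a, c)
  simp only [extR, gb_iff, List.isChain_cons] at h ⊢
  obtain ⟨⟨⟨h1, h2⟩, h3⟩, h4, ⟨⟨h5, h6⟩, h7⟩, h8, h9⟩ := h
  constructor
  · rintro ⟨-, ⟨-, h⟩, -, ⟨-, h'⟩, -⟩
    exact ⟨h.1 c hc, fun d hd => h'.1 d hd⟩
  · rintro ⟨h, h'⟩
    have hh := hco h
    simp only at hh
    have hv := h2 c hc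
    refine ⟨by simp_all, ⟨⟨⟨?_, h1⟩, by simp⟩, ?_, h3⟩, by simp [h4],
      ⟨⟨⟨?_, h5⟩, by simp⟩, h', h7⟩, trivial, ?_⟩
    · intro x hx; simp_all
    · intro x hx; simp_all
    · intro x hx; rw [h6 x hx, hh, hv, h8]
    · rw [List.getLast?_cons, List.getLast?_cons]
      simp only [Option.elim_some]
      obtain ⟨z, hz⟩ := Option.ne_none_iff_exists'.1 (mt List.getLast?_eq_none_iff.1 hne)
      rw [hz] at h9 ⊢
      cases hl : l'.getLast? with
      | none => simp_all
      | some y => simp_all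

theorem unextL {Q : Quiv} {R : Set (Q.A × Q.A)} {m : ℕ} {v w : Q.V}
    {l l' : List Q.A} {b : Q.A} (h : GBmem Q R (m + 2) ((v, l ++ [b]), (w, l' ++ [b]))) :
    GBmem Q R (m + 1) ((v, l), (w, l')) := by
  simp only [gb_iff, List.isChain_append, List.isChain_singleton] at h ⊢
  obtain ⟨⟨⟨h1, h2⟩, h3⟩, h4, ⟨⟨h5, h6⟩, h7⟩, h8, h9⟩ := h
  simp at h4
  refine ⟨⟨⟨h1.1, ?_⟩, h3.1⟩, h4, ⟨⟨h5.1, ?_⟩, h7.1⟩, h8, ?_⟩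
  · intro a ha; apply h2; cases l <;> simp_all
  · intro a ha; apply h6; cases l' <;> simp_all
  · have hne : l ≠ [] := by rintro rfl; simp at h4
    obtain ⟨z, hz⟩ := Option.ne_none_iff_exists'.1 (mt List.getLast?_eq_none_iff.1 hne)
    have e1 := h1.2.2 z hz b rfl
    rw [hz]
    cases hl : l'.getLast? with
    | none =>
      have : l' = [] := List.getLast?_eq_none_iff.1 hl
      subst this
      have := h6 b rfl
      simp_all
    | some y =>
      have e2 := h5.2.2 y hl b rfl
      simp_all

theorem unextR {Q : Quiv} {R : Set (Q.A × Q.A)} {m : ℕ} {v w : Q.V}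
    {l l' : List Q.A} {a : Q.A} (h : GBmem Q R (m + 2) ((v, a :: l), (w, a :: l'))) :
    GBmem Q R (m + 1) ((Q.tgt a, l), (Q.tgt a, l')) ∧ v = Q.src a ∧ w = Q.src a := by
  simp only [gb_iff, List.isChain_cons] at h ⊢
  obtain ⟨⟨⟨h1, h2⟩, h3⟩, h4, ⟨⟨h5, h6⟩, h7⟩, h8, h9⟩ := h
  simp at h4
  refine ⟨⟨⟨⟨h1.2, ?_⟩, h3.2⟩, h4, ⟨⟨h5.2, ?_⟩, h7.2⟩, trivial, ?_⟩, (h2 a rfl).symm, (h6 a rfl).symm⟩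
  · intro x hx; exact (h1.1 x hx).symm
  · intro x hx; exact (h5.1 x hx).symm
  · rw [List.getLast?_cons, List.getLast?_cons] at h9
    cases h1 : l.getLast? <;> cases h2 : l'.getLast? <;> simp_all

/-! ### The differential -/

noncomputable def TL (k : Type) [Field k] (Q : Quiv) (R : Set (Q.A × Q.A)) (m : ℕ)
    (x : GB Q R m) : Coch k Q R (m + 1) := by
  classical
  exact
    (∑ b : Q.A,
      if h : GBmem Q R (m + 1) (extL Q b x.val.1, extL Q b x.val.2) then
        Finsupp.single (⟨_, h⟩ : GB Q R (m + 1)) (1 : k) else 0)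

noncomputable def TR (k : Type) [Field k] (Q : Quiv) (R : Set (Q.A × Q.A)) (m : ℕ)
    (x : GB Q R m) : Coch k Q R (m + 1) := by
  classical
  exact
      (∑ a : Q.A,
        if h : Q.tgt a = psrc Q x.val.1 ∧
            GBmem Q R (m + 1) (extR Q a x.val.1, extR Q a x.val.2) then
          Finsupp.single (⟨_, h.2⟩ : GB Q R (m + 1)) (1 : k) else 0)

theorem dB_eq (k : Type) [Field k] (Q : Quiv) (R : Set (Q.A × Q.A)) (m : ℕ)
    (x : GB Q R m) : dB k Q R m x = TL k Q R m x - ((-1 : k) ^ m) • TR k Q R m x := rfl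

theorem dLin_single (k : Type) [Field k] (Q : Quiv) (R : Set (Q.A × Q.A)) (m : ℕ)
    (x : GB Q R m) (c : k) : dLin k Q R m (Finsupp.single x c) = c • dB k Q R m x := by
  simp [dLin]

theorem TL_zero {k : Type} [Field k] {Q : Quiv} {R : Set (Q.A × Q.A)} {m : ℕ}
    {x : GB Q R m} (h : ∀ b, ¬ GBmem Q R (m + 1) (extL Q b x.val.1, extL Q b x.val.2)) :
    TL k Q R m x = 0 := by
  unfold TL
  exact Finset.sum_eq_zero fun b _ => dif_neg (h b)

theorem TR_zero {k : Type} [Field k] {Q : Quiv} {R : Set (Q.A × Q.A)} {m : ℕ}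
    {x : GB Q R m} (h : ∀ a, ¬ (Q.tgt a = psrc Q x.val.1 ∧
      GBmem Q R (m + 1) (extR Q a x.val.1, extR Q a x.val.2))) :
    TR k Q R m x = 0 := by
  unfold TR
  exact Finset.sum_eq_zero fun b _ => dif_neg (h b)

theorem last_ex {α : Type} {l : List α} {m : ℕ} (h : l.length = m + 1) :
    ∃ c, l.getLast? = some c :=
  Option.ne_none_iff_exists'.1 (mt List.getLast?_eq_none_iff.1 (by rintro rfl; simp at h))

theorem head_ex {α : Type} {l : List α} {m : ℕ} (h : l.length = m + 1) :
    ∃ c, l.head? = some c :=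
  Option.ne_none_iff_exists'.1 (mt List.head?_eq_none_iff.1 (by rintro rfl; simp at h))

theorem TL_single {k : Type} [Field k] {Q : Quiv} {R : Set (Q.A × Q.A)} (hg : IsGentle Q R)
    {m : ℕ} {x : GB Q R (m + 1)} (b : Q.A)
    (h : GBmem Q R (m + 1 + 1) (extL Q b x.val.1, extL Q b x.val.2)) :
    TL k Q R (m + 1) x = Finsupp.single ⟨_, h⟩ 1 := by
  unfold TL
  rw [Finset.sum_eq_single b]
  · exact dif_pos h
  · intro b' _ hb'
    apply dif_neg
    intro h'
    apply hb'
    obtain ⟨⟨⟨v, l⟩, ⟨w, l'⟩⟩, hx⟩ := x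
    obtain ⟨c, hc⟩ := last_ex hx.2.1
    have e1 := ((extL_iff hg hx hc b).1 h).1
    have e2 := ((extL_iff hg hx hc b').1 h').1
    exact hg.uniqRelAfter c ⟨hg.relComposable _ e2, e2⟩ ⟨hg.relComposable _ e1, e1⟩
  · simp

theorem TR_single {k : Type} [Field k] {Q : Quiv} {R : Set (Q.A × Q.A)} (hg : IsGentle Q R)
    {m : ℕ} {x : GB Q R (m + 1)} (a : Q.A)
    (h : Q.tgt a = psrc Q x.val.1 ∧
      GBmem Q R (m + 1 + 1) (extR Q a x.val.1, extR Q a x.val.2)) :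
    TR k Q R (m + 1) x = Finsupp.single ⟨_, h.2⟩ 1 := by
  unfold TR
  rw [Finset.sum_eq_single a]
  · exact dif_pos h
  · intro b' _ hb'
    apply dif_neg
    intro h'
    apply hb'
    obtain ⟨⟨⟨v, l⟩, ⟨w, l'⟩⟩, hx⟩ := x
    obtain ⟨c, hc⟩ := head_ex hx.2.1
    have e1 := ((extR_iff hg hx hc a).1 h).1
    have e2 := ((extR_iff hg hx hc b').1 h').1
    exact hg.uniqRelBefore c ⟨hg.relComposable _ e2, e2⟩ ⟨hg.relComposable _ e1, e1⟩
  · simp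

theorem not_cob_of {k : Type} [Field k] {Q : Quiv} {R : Set (Q.A × Q.A)}
    {m : ℕ} {u : GB Q R (m + 1)} (φ : Coch k Q R (m + 1) →ₗ[k] k)
    (h0 : ∀ x, φ (dB k Q R m x) = 0) (hu : φ (Finsupp.single u 1) ≠ 0) :
    ¬ ∃ y : Coch k Q R m, dLin k Q R m y = Finsupp.single u (1 : k) := by
  rintro ⟨y, hy⟩
  apply hu
  rw [← hy]
  have : φ ∘ₗ dLin k Q R m = 0 := by
    ext x
    simp [dLin_single, h0]
  exact LinearMap.congr_fun this y

theorem not_cob_of_ne {k : Type} [Field k] {Q : Quiv} {R : Set (Q.A × Q.A)}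
    (hg : IsGentle Q R) {m : ℕ} {u : GB Q R (m + 1 + 1)}
    (h1 : u.val.1.2.head? ≠ u.val.2.2.head?)
    (h2 : u.val.1.2.getLast? ≠ u.val.2.2.getLast?) :
    ¬ ∃ y : Coch k Q R (m + 1), dLin k Q R (m + 1) y = Finsupp.single u (1 : k) := by
  apply not_cob_of (Finsupp.lapply u)
  · intro x
    rw [dB_eq]
    have e1 : TL k Q R (m + 1) x u = 0 := by
      by_cases h : ∃ b, GBmem Q R (m + 1 + 1) (extL Q b x.val.1, extL Q b x.val.2)
      · obtain ⟨b, hb⟩ := h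
        rw [TL_single hg b hb, Finsupp.single_eq_of_ne]
        rintro rfl
        simp [extL] at h2
      · push Not at h
        rw [TL_zero h]; rfl
    have e2 : TR k Q R (m + 1) x u = 0 := by
      by_cases h : ∃ a, Q.tgt a = psrc Q x.val.1 ∧
          GBmem Q R (m + 1 + 1) (extR Q a x.val.1, extR Q a x.val.2)
      · obtain ⟨b, hb⟩ := h
        rw [TR_single hg b hb, Finsupp.single_eq_of_ne]
        rintro rfl
        simp [extR] at h1
      · push Not at h
        rw [TR_zero (by simpa using h)]; rfl
    simp [e1, e2]
  · simp

/-! ### Complete cycles -/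

/-- A list of arrows which is a complete cycle. -/
def CL (Q : Quiv) (R : Set (Q.A × Q.A)) (l : List Q.A) : Prop :=
  l ≠ [] ∧ (l ++ l).IsChain (fun a b => (a, b) ∈ R)

theorem CL_swap {Q : Quiv} {R : Set (Q.A × Q.A)} {p q : List Q.A} (h : CL Q R (p ++ q)) :
    CL Q R (q ++ p) := by
  refine ⟨fun h' => h.1 (by simp_all), ?_⟩
  have h3 : ((p ++ q) ++ ((p ++ q) ++ (p ++ q))).IsChain (fun a b => (a, b) ∈ R) := by
    rw [List.isChain_append]
    refine ⟨(List.isChain_append.1 h.2).1, h.2, ?_⟩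
    intro x hx y hy
    apply (List.isChain_append.1 h.2).2.2 x hx y
    rw [List.head?_append_of_ne_nil _ h.1] at hy
    exact hy
  exact h3.infix ⟨p, q, by simp⟩

theorem CL_last_head {Q : Quiv} {R : Set (Q.A × Q.A)} {l : List Q.A} (h : CL Q R l)
    {a b : Q.A} (ha : l.getLast? = some a) (hb : l.head? = some b) : (a, b) ∈ R :=
  (List.isChain_append.1 h.2).2.2 a ha b hb

theorem CL_mk {Q : Quiv} {R : Set (Q.A × Q.A)} {l : List Q.A}
    (hl : l.IsChain (fun a b => (a, b) ∈ R))
    {a b : Q.A} (ha : l.getLast? = some a) (hb : l.head? = some b) (h : (a, b) ∈ R) :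
    CL Q R l := by
  refine ⟨by rintro rfl; simp at ha, List.isChain_append.2 ⟨hl, hl, ?_⟩⟩
  intro x hx y hy
  simp_all

theorem CL_of_complete {Q : Quiv} {R : Set (Q.A × Q.A)} {C : PathDat Q} (h : Complete Q R C) :
    CL Q R C.2 := by
  refine ⟨h.1.2.1, ?_⟩
  have h2 : (C.2 ++ (C.2 ++ [])).IsChain (fun a b => (a, b) ∈ R) := h.2.2
  rwa [List.append_nil] at h2

theorem complete_of_CL {Q : Quiv} {R : Set (Q.A × Q.A)} (hg : IsGentle Q R) {v : Q.V}
    {l : List Q.A} (hO : Ok Q (v, l)) (h : CL Q R l) :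
    Complete Q R (v, l) := by
  have hch : (l ++ l).IsChain (fun a b => Q.tgt a = Q.src b) :=
    h.2.imp fun a b hab => hg.relComposable _ hab
  refine ⟨⟨hO, h.1, ?_⟩, ⟨?_, ?_⟩, ?_⟩
  · obtain ⟨a, ha⟩ := Option.ne_none_iff_exists'.1 (mt List.getLast?_eq_none_iff.1 h.1)
    obtain ⟨b, hb⟩ := Option.ne_none_iff_exists'.1 (mt List.head?_eq_none_iff.1 h.1)
    have := hg.relComposable _ (CL_last_head h ha hb)
    simp only at this
    simp only [psrc, ptgt, ha, Option.elim_some, this]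
    exact (hO.2 b hb).symm
  · change (l ++ (l ++ [])).IsChain (fun a b => Q.tgt a = Q.src b)
    rwa [List.append_nil]
  · intro a ha
    apply hO.2
    simpa [powP, powL, List.head?_append_of_ne_nil _ h.1] using ha
  · change (l ++ (l ++ [])).IsChain (fun a b => (a, b) ∈ R)
    rw [List.append_nil]
    exact h.2

theorem CL_gb {Q : Quiv} {R : Set (Q.A × Q.A)} (hg : IsGentle Q R) {c : Q.A}
    {l : List Q.A} (h : CL Q R l) (hc : l.head? = some c) {n : ℕ} (hn : l.length = n) :
    GBmem Q R n ((Q.src c, l), (Q.src c, [])) := by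
  have hG := (List.isChain_append.1 h.2).1
  have hO : Ok Q (Q.src c, l) := ⟨hG.imp fun a b hab => hg.relComposable _ hab, by simp [hc]⟩
  have := complete_of_CL hg hO h
  refine ⟨⟨hO, hG⟩, hn, ⟨⟨List.isChain_nil, by simp⟩, List.isChain_nil⟩, rfl, ?_⟩
  exact this.1.2.2.symm

/-- The element `(bC, b)` attached to a list of arrows `C` with first arrow `b`. -/
noncomputable def Xv (k : Type) [Field k] (Q : Quiv) (R : Set (Q.A × Q.A)) (n : ℕ) :
    List Q.A → Coch k Q R n
  | [] => 0
  | c :: l => bv k Q R n ((Q.src c, c :: l ++ [c]), (Q.src c, [c]))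

theorem bv_pos {k : Type} [Field k] {Q : Quiv} {R : Set (Q.A × Q.A)} {n : ℕ}
    {x : PathDat Q × PathDat Q} (h : GBmem Q R n x) :
    bv k Q R n x = Finsupp.single ⟨x, h⟩ 1 := dif_pos h

theorem rot_step {k : Type} [Field k] {Q : Quiv} {R : Set (Q.A × Q.A)} (hg : IsGentle Q R)
    {n : ℕ} {c : Q.A} {l : List Q.A} (h : CL Q R (c :: l)) (hn : (c :: l).length = n + 1) :
    ∃ y, dLin k Q R (n + 1) y =
      Xv k Q R (n + 1 + 1) (l ++ [c]) - (-1 : k) ^ (n + 1) • Xv k Q R (n + 1 + 1) (c :: l) := by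
  have h' : CL Q R (l ++ [c]) := CL_swap (p := [c]) (q := l) h
  have hn' : (l ++ [c]).length = n + 1 := by simpa using hn
  obtain ⟨e, l2, he⟩ : ∃ e l2, l ++ [c] = e :: l2 := by
    cases hh : l ++ [c] with
    | nil => simp at hh
    | cons e l2 => exact ⟨e, l2, rfl⟩
  have hce : (c, e) ∈ R := CL_last_head h' (by simp) (by simp [he])
  have hx : GBmem Q R (n + 1) ((Q.src e, l ++ [c]), (Q.src e, [])) :=
    CL_gb hg h' (by simp [he]) hn'
  have hL := (extL_iff hg hx (c := c) (by simp) e).2 ⟨hce, by simp⟩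
  have hR := (extR_iff hg hx (c := e) (by simp [he]) c).2 ⟨hce, by simp⟩
  refine ⟨Finsupp.single ⟨_, hx⟩ 1, ?_⟩
  rw [dLin_single, one_smul, dB_eq, TL_single hg e hL, TR_single (x := ⟨_, hx⟩) hg c hR]
  congr 2
  · have e1 : Xv k Q R (n + 1 + 1) (l ++ [c]) =
        bv k Q R (n + 1 + 1) ((Q.src e, (l ++ [c]) ++ [e]), (Q.src e, [e])) := by
      rw [he]; rfl
    rw [e1]
    exact (bv_pos hL).symm
  · exact (bv_pos hR.2).symm

theorem rot_iter {k : Type} [Field k] {Q : Quiv} {R : Set (Q.A × Q.A)} (hg : IsGentle Q R)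
    {n : ℕ} {l : List Q.A} (h : CL Q R l) (hn : l.length = n + 1) (i : ℕ) :
    ∃ y, dLin k Q R (n + 1) y =
      Xv k Q R (n + 1 + 1) (l.rotate i) -
        ((-1 : k) ^ (n + 1)) ^ i • Xv k Q R (n + 1 + 1) l := by
  induction i generalizing l with
  | zero => exact ⟨0, by simp⟩
  | succ i ih =>
    obtain _ | ⟨c, l0⟩ := l
    · simp at hn
    · obtain ⟨y, hy⟩ := rot_step (k := k) hg h hn
      obtain ⟨z, hz⟩ := ih (l := l0 ++ [c]) (CL_swap (p := [c]) h) (by simpa using hn)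
      refine ⟨z + ((-1 : k) ^ (n + 1)) ^ i • y, ?_⟩
      rw [map_add, map_smul, hy, hz, List.rotate_cons_succ, pow_succ _ i, smul_sub, smul_smul,
        sub_add_sub_cancel]

theorem cyc_cob {k : Type} [Field k] {Q : Quiv} {R : Set (Q.A × Q.A)} (hg : IsGentle Q R)
    {n : ℕ} {l : List Q.A} (h : CL Q R l) (hn : l.length = n + 1) (hodd : Odd (n + 1))
    (h2 : ringChar k ≠ 2) :
    ∃ y, dLin k Q R (n + 1) y = Xv k Q R (n + 1 + 1) l := by
  have h20 : (2 : k) ≠ 0 := fun h0 =>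
    h2 (CharP.ringChar_of_prime_eq_zero Nat.prime_two (by exact_mod_cast h0))
  obtain ⟨y, hy⟩ := rot_iter (k := k) hg h hn (n + 1)
  have hrot : l.rotate (n + 1) = l := by rw [← hn, List.rotate_length]
  rw [hrot, hodd.neg_one_pow, hodd.neg_one_pow] at hy
  refine ⟨(2 : k)⁻¹ • y, ?_⟩
  rw [map_smul, hy, neg_one_smul, sub_neg_eq_add, ← two_smul k, smul_smul, inv_mul_cancel₀ h20,
    one_smul]

/-- The basis elements of the form `(bC, b)`. -/
def IsX (Q : Quiv) (R : Set (Q.A × Q.A)) (x : PathDat Q × PathDat Q) : Prop :=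
  ∃ l b, CL Q R l ∧ l.head? = some b ∧ x.1.2 = l ++ [b] ∧ x.2.2 = [b]

open Classical in
noncomputable def phi (k : Type) [Field k] (Q : Quiv) (R : Set (Q.A × Q.A)) (n : ℕ) :
    Coch k Q R n →ₗ[k] k :=
  Finsupp.linearCombination k (fun x : GB Q R n => if IsX Q R x.val then (1 : k) else 0)

open Classical in
theorem phi_single {k : Type} [Field k] {Q : Quiv} {R : Set (Q.A × Q.A)} {n : ℕ}
    (x : GB Q R n) : phi k Q R n (Finsupp.single x 1) = if IsX Q R x.val then (1 : k) else 0 := by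
  simp [phi]

open Classical in
theorem phi_TL {k : Type} [Field k] {Q : Quiv} {R : Set (Q.A × Q.A)} (hg : IsGentle Q R)
    {m : ℕ} (x : GB Q R (m + 1)) :
    phi k Q R (m + 1 + 1) (TL k Q R (m + 1) x) =
      if x.val.2.2 = [] ∧ CL Q R x.val.1.2 then (1 : k) else 0 := by
  obtain ⟨⟨⟨v, l⟩, ⟨w, l'⟩⟩, hx⟩ := x
  obtain ⟨c, hc⟩ := last_ex hx.2.1
  obtain ⟨e, he⟩ := head_ex hx.2.1
  simp only at hc he
  by_cases h : ∃ b, GBmem Q R (m + 1 + 1) (extL Q b (v, l), extL Q b (w, l'))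
  · obtain ⟨b, hb⟩ := h
    rw [TL_single hg b hb, phi_single]
    have hcb := ((extL_iff hg hx hc b).1 hb).1
    congr 1
    apply propext
    constructor
    · rintro ⟨l1, b1, h1, h2, h3, h4⟩
      simp only [extL] at h3 h4
      have h5 := List.append_inj_left' h3 rfl
      subst h5
      refine ⟨?_, h1⟩
      simpa using congrArg List.length h4
    · rintro ⟨h1, h2⟩
      simp only at h1 h2
      have hce := CL_last_head h2 hc he
      have : b = e :=
        hg.uniqRelAfter c ⟨hg.relComposable _ hcb, hcb⟩ ⟨hg.relComposable _ hce, hce⟩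
      subst this
      exact ⟨l, b, h2, he, rfl, by simp [extL, h1]⟩
  · push Not at h
    rw [TL_zero h, map_zero, if_neg]
    rintro ⟨h1, h2⟩
    simp only at h1 h2
    subst h1
    exact h e ((extL_iff hg hx hc e).2 ⟨CL_last_head h2 hc he, by simp⟩)

open Classical in
theorem phi_TR {k : Type} [Field k] {Q : Quiv} {R : Set (Q.A × Q.A)} (hg : IsGentle Q R)
    {m : ℕ} (x : GB Q R (m + 1)) :
    phi k Q R (m + 1 + 1) (TR k Q R (m + 1) x) =
      if x.val.2.2 = [] ∧ CL Q R x.val.1.2 then (1 : k) else 0 := by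
  obtain ⟨⟨⟨v, l⟩, ⟨w, l'⟩⟩, hx⟩ := x
  obtain ⟨c, hc⟩ := last_ex hx.2.1
  obtain ⟨e, he⟩ := head_ex hx.2.1
  simp only at hc he
  by_cases h : ∃ a, Q.tgt a = v ∧ GBmem Q R (m + 1 + 1) (extR Q a (v, l), extR Q a (w, l'))
  · obtain ⟨a, ha⟩ := h
    rw [TR_single (x := ⟨_, hx⟩) hg a ha, phi_single]
    have hae := ((extR_iff hg hx he a).1 ha).1
    congr 1
    apply propext
    constructor
    · rintro ⟨l1, b1, h1, h2, h3, h4⟩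
      simp only [extR] at h3 h4
      obtain ⟨rfl, rfl⟩ : a = b1 ∧ l' = [] := by simpa using h4
      obtain _ | ⟨a1, l2⟩ := l1
      · simp at h2
      · obtain rfl : a1 = a := by simpa using h2
        obtain rfl : l = l2 ++ [a1] := by simpa using h3
        exact ⟨rfl, CL_swap (p := [a1]) h1⟩
    · rintro ⟨h1, h2⟩
      simp only at h1 h2
      have hce := CL_last_head h2 hc he
      have : a = c :=
        hg.uniqRelBefore e ⟨hg.relComposable _ hae, hae⟩ ⟨hg.relComposable _ hce, hce⟩
      subst this
      obtain ⟨l2, rfl⟩ := List.getLast?_eq_some_iff.1 hc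
      exact ⟨a :: l2, a, CL_swap (q := [a]) h2, rfl, by simp [extR], by simp [extR, h1]⟩
  · push Not at h
    rw [TR_zero (by simpa [psrc] using h), map_zero, if_neg]
    rintro ⟨h1, h2⟩
    simp only at h1 h2
    subst h1
    have := (extR_iff hg hx he c).2 ⟨CL_last_head h2 hc he, by simp⟩
    exact h c this.1 this.2

theorem not_cob_cyc {k : Type} [Field k] {Q : Quiv} {R : Set (Q.A × Q.A)} (hg : IsGentle Q R)
    {m : ℕ} (u : GB Q R (m + 1 + 1)) (hm : (1 : k) - (-1) ^ (m + 1) = 0) (hu : IsX Q R u.val) :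
    ¬ ∃ y : Coch k Q R (m + 1), dLin k Q R (m + 1) y = Finsupp.single u (1 : k) := by
  apply not_cob_of (phi k Q R _)
  · intro x
    rw [dB_eq, map_sub, map_smul, phi_TL hg, phi_TR hg]
    split_ifs
    · simpa using hm
    · simp
  · rw [phi_single, if_pos hu]
    exact one_ne_zero

theorem append_eq_cons {α : Type} {a b : α} {l : List α} (h : l ++ [b] = a :: l) :
    l = List.replicate l.length a ∧ b = a := by
  induction l generalizing a with
  | nil => simpa using h
  | cons x l ih =>
    simp only [List.cons_append, List.cons.injEq] at h
    obtain ⟨rfl, h⟩ := h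
    obtain ⟨h1, h2⟩ := ih h
    refine ⟨?_, h2⟩
    rw [List.length_cons, List.replicate_succ, ← h1]

theorem sign_even {k : Type} [Field k] {n : ℕ} :
    ((1 : k) - (-1) ^ n = 0) ↔ (Even n ∨ ringChar k = 2) := by
  constructor
  · intro h
    rcases Nat.even_or_odd n with h' | h'
    · exact Or.inl h'
    · right
      rw [h'.neg_one_pow] at h
      apply CharP.ringChar_of_prime_eq_zero Nat.prime_two
      push_cast
      rw [← h]; ring
  · rintro (h | h)
    · simp [h.neg_one_pow]
    · have : CharP k 2 := h ▸ ringChar.charP k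
      rw [CharTwo.neg_eq, one_pow, sub_self]

theorem gmax_or {Q : Quiv} {R : Set (Q.A × Q.A)} {p : PathDat Q} (hp : InG Q R p)
    {c e : Q.A} (hc : p.2.getLast? = some c) (he : p.2.head? = some e)
    (h1 : ∀ b, (c, b) ∉ R) (h2 : ∀ a, (a, e) ∉ R) : GMax Q R p := by
  refine ⟨hp, ?_⟩
  rintro q hq ⟨s, t, hst⟩
  have hch : (s ++ p.2 ++ t).IsChain (fun a b => (a, b) ∈ R) := hst ▸ hq.2
  have hne : p.2 ≠ [] := by intro h; simp [h] at hc
  have ht : t = [] := by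
    obtain _ | ⟨b, t⟩ := t
    · rfl
    · exact absurd ((List.isChain_append.1 hch).2.2 c (by simp [List.getLast?_append, hc]) b rfl)
        (h1 b)
  have hs : s = [] := by
    by_contra hs
    obtain ⟨a, ha⟩ := Option.ne_none_iff_exists'.1 (mt List.getLast?_eq_none_iff.1 hs)
    exact h2 a ((List.isChain_append.1 (List.isChain_append.1 hch).1).2.2 a ha e he)
  simpa [ht, hs] using hst

/-- Let `(Q, R)` be a gentle presentation and `m = m' + 2 ≥ 2`.
An element `u` of `Γ_m ∥ B` is a cocycle and not a coboundary if and only if: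
(i) `m` is even or `char k = 2`, and `u = (b^m, s(b))` for a loop `b`; or
(ii) `m` is odd or `char k = 2`, and `u = (bC, b)` for a complete cycle `C`
with first arrow `b`; or (iii) `u = (γ, α)` with `γ` a `Γ`-maximal element of
`Γ_m` and `γ` and `α` neither starting nor ending with the same arrow. -/
theorem rank_one_cocycles_high_degree (k : Type) [Field k] (Q : Quiv)
    (R : Set (Q.A × Q.A)) (hg : IsGentle Q R) (m' : ℕ) (u : GB Q R (m' + 2)) :
    (dLin k Q R (m' + 2) (Finsupp.single u (1 : k)) = 0 ∧
        ¬∃ y : Coch k Q R (m' + 1), dLin k Q R (m' + 1) y = Finsupp.single u (1 : k)) ↔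
    (((Even (m' + 2) ∨ ringChar k = 2) ∧ ∃ b : Q.A, Q.src b = Q.tgt b ∧
        u.val = ((Q.src b, List.replicate (m' + 2) b), (Q.src b, []))) ∨
     ((Odd (m' + 2) ∨ ringChar k = 2) ∧ ∃ (C : PathDat Q) (b : Q.A),
        Complete Q R C ∧ C.2.head? = some b ∧
        u.val = ((C.1, C.2 ++ [b]), (Q.src b, [b]))) ∨
     (GMax Q R u.val.1 ∧ u.val.1.2.head? ≠ u.val.2.2.head? ∧
        u.val.1.2.getLast? ≠ u.val.2.2.getLast?)) := by
  obtain ⟨⟨⟨v, l⟩, ⟨w, l'⟩⟩, hu⟩ := u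
  have hlen : l.length = m' + 1 + 1 := hu.2.1
  obtain rfl : v = w := hu.2.2.2.1
  obtain ⟨c, hc⟩ := last_ex hlen
  obtain ⟨e, he⟩ := head_ex hlen
  have hd : dLin k Q R (m' + 2) (Finsupp.single ⟨((v, l), (v, l')), hu⟩ (1 : k)) =
      dB k Q R (m' + 1 + 1) ⟨((v, l), (v, l')), hu⟩ := by
    rw [dLin_single, one_smul]
  rw [hd]
  have uA : ∀ {a b b' : Q.A}, (a, b) ∈ R → (a, b') ∈ R → b = b' := fun {a b b'} h h' =>
    hg.uniqRelAfter a ⟨hg.relComposable _ h, h⟩ ⟨hg.relComposable _ h', h'⟩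
  have uB : ∀ {a a' b : Q.A}, (a, b) ∈ R → (a', b) ∈ R → a = a' := fun {a a' b} h h' =>
    hg.uniqRelBefore b ⟨hg.relComposable _ h, h⟩ ⟨hg.relComposable _ h', h'⟩
  have hLu := extL_iff hg hu hc
  have hRu := extR_iff hg hu he
  constructor
  · rintro ⟨hcoc, hcob⟩
    rw [dB_eq] at hcoc
    by_cases hlast : l.getLast? = l'.getLast?
    · right; left
      obtain ⟨l0, rfl⟩ := List.getLast?_eq_some_iff.1 hc
      obtain ⟨l0', rfl⟩ := List.getLast?_eq_some_iff.1 (hlast ▸ hc)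
      have hx := unextL hu
      have hlen0 : l0.length = m' + 1 := by simpa using hlen
      obtain ⟨c0, hc0⟩ := last_ex hlen0
      obtain ⟨e0, he0⟩ := head_ex hlen0
      have hce0 : e0 = e := by
        rw [List.head?_append, he0] at he
        simpa using he
      subst hce0
      have hTLx : TL k Q R (m' + 1) ⟨_, hx⟩ = Finsupp.single ⟨_, hu⟩ 1 :=
        TL_single (x := ⟨_, hx⟩) hg c hu
      have hc0c := ((extL_iff hg hx hc0 c).1 hu).1
      have hTLu : TL k Q R (m' + 1 + 1) ⟨_, hu⟩ = 0 := by
        apply TL_zero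
        intro b hb
        have := (hLu b).1 hb
        exact this.2 c (by simp) this.1
      obtain ⟨a, ha⟩ : ∃ a, Q.tgt a = v ∧
          GBmem Q R (m' + 1 + 1) (extR Q a (v, l0), extR Q a (v, l0')) := by
        by_contra hno
        push Not at hno
        apply hcob
        refine ⟨Finsupp.single ⟨_, hx⟩ 1, ?_⟩
        rw [dLin_single, one_smul, dB_eq, hTLx,
          TR_zero (x := ⟨_, hx⟩) (by simpa [psrc] using hno), smul_zero, sub_zero]
      have hax := (extR_iff hg hx he0 a).1 ha
      have hnR : ¬ (Q.tgt a = v ∧ GBmem Q R (m' + 2 + 1)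
          (extR Q a (v, l0 ++ [c]), extR Q a (v, l0' ++ [c]))) := by
        intro h
        rw [hTLu, TR_single (x := ⟨_, hu⟩) hg a h] at hcoc
        simp at hcoc
      rw [hRu a] at hnR
      have hl0' : l0' = [] := by
        by_contra hne
        apply hnR
        rw [List.head?_append_of_ne_nil _ hne]
        exact hax
      subst hl0'
      have hac : (a, c) ∈ R := by
        by_contra h
        apply hnR
        refine ⟨hax.1, ?_⟩
        simpa using h
      obtain rfl : a = c0 := uB hac hc0c
      obtain rfl : e0 = c := uA hax.1 hc0c
      have hCL : CL Q R l0 := CL_mk hx.1.2 hc0 he0 hax.1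
      have hv : Q.src e0 = v := hx.1.1.2 e0 he0
      refine ⟨?_, (v, l0), e0, complete_of_CL hg hx.1.1 hCL, he0, by simp [hv]⟩
      by_contra hpar
      push Not at hpar
      have hodd : Odd (m' + 1) := by
        have := hpar.1
        rw [Nat.not_odd_iff_even] at this
        rcases Nat.even_or_odd (m' + 1) with h | h
        · exact absurd this (by simpa [parity_simps] using h)
        · exact h
      obtain ⟨y, hy⟩ := cyc_cob (k := k) hg hCL hlen0 hodd hpar.2
      apply hcob
      refine ⟨y, ?_⟩
      rw [hy]
      obtain _ | ⟨e1, l1⟩ := l0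
      · simp at he0
      · obtain rfl : e1 = e0 := by simpa using he0
        subst hv
        exact bv_pos hu
    · by_cases hhead : l.head? = l'.head?
      · exfalso
        obtain ⟨l0, rfl⟩ := List.head?_eq_some_iff.1 he
        obtain ⟨l0', rfl⟩ := List.head?_eq_some_iff.1 (hhead ▸ he)
        obtain ⟨hx, rfl, -⟩ := unextR hu
        have hlen0 : l0.length = m' + 1 := by simpa using hlen
        obtain ⟨c0, hc0⟩ := last_ex hlen0
        obtain ⟨e0, he0⟩ := head_ex hlen0
        have hcc0 : c0 = c := by
          rw [List.getLast?_cons, hc0] at hc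
          simpa using hc
        subst hcc0
        have hTRx : TR k Q R (m' + 1) ⟨_, hx⟩ = Finsupp.single ⟨_, hu⟩ 1 :=
          TR_single (x := ⟨_, hx⟩) hg e ⟨rfl, hu⟩
        have hTRu : TR k Q R (m' + 1 + 1) ⟨_, hu⟩ = 0 := by
          apply TR_zero
          intro b hb
          have := (hRu b).1 hb
          exact this.2 e (by simp) this.1
        obtain ⟨b, hb⟩ : ∃ b,
            GBmem Q R (m' + 1 + 1) (extL Q b (Q.tgt e, l0), extL Q b (Q.tgt e, l0')) := by
          by_contra hno
          push Not at hno
          apply hcob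
          refine ⟨Finsupp.single ⟨_, hx⟩ (-(-1) ^ (m' + 1)), ?_⟩
          rw [dLin_single, dB_eq, hTRx, TL_zero (x := ⟨_, hx⟩) hno, zero_sub, smul_neg, neg_smul,
            neg_neg, smul_smul, ← mul_pow]
          simp
        have hbx := (extL_iff hg hx hc0 b).1 hb
        have hnL : ¬ GBmem Q R (m' + 2 + 1)
            (extL Q b (Q.src e, e :: l0), extL Q b (Q.src e, e :: l0')) := by
          intro h
          rw [hTRu, TL_single (x := ⟨_, hu⟩) hg b h] at hcoc
          simp at hcoc
        rw [hLu b] at hnL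
        have hl0' : l0' = [] := by
          by_contra hne
          apply hnL
          refine ⟨hbx.1, ?_⟩
          intro d hd
          apply hbx.2
          rw [List.getLast?_cons_of_ne_nil hne] at hd
          exact hd
        subst hl0'
        have heb : (e, b) ∈ R := by
          by_contra h
          apply hnL
          refine ⟨hbx.1, ?_⟩
          simpa using h
        obtain rfl : e = c0 := uB heb hbx.1
        apply hlast
        rw [hc]
        rfl
      · by_cases hmax : GMax Q R (v, l)
        · exact Or.inr (Or.inr ⟨hmax, hhead, hlast⟩)
        · left
          have hL' : ∀ b, (c, b) ∈ R →
              GBmem Q R (m' + 2 + 1) (extL Q b (v, l), extL Q b (v, l')) := by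
            intro b hb
            refine (hLu b).2 ⟨hb, fun d hd hdb => ?_⟩
            obtain rfl := uB hb hdb
            exact hlast (hc.trans hd.symm)
          have hR' : ∀ a, (a, e) ∈ R → (Q.tgt a = v ∧
              GBmem Q R (m' + 2 + 1) (extR Q a (v, l), extR Q a (v, l'))) := by
            intro a ha
            refine (hRu a).2 ⟨ha, fun d hd hdb => ?_⟩
            obtain rfl := uA ha hdb
            exact hhead (he.trans hd.symm)
          by_cases h1 : ∃ b, (c, b) ∈ R
          · obtain ⟨b, hb⟩ := h1
            have hTL := TL_single (k := k) (x := ⟨_, hu⟩) hg b (hL' b hb)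
            by_cases h2 : ∃ a, (a, e) ∈ R
            · obtain ⟨a, ha⟩ := h2
              have hTR := TR_single (k := k) (x := ⟨_, hu⟩) hg a (hR' a ha)
              rw [hTL, hTR] at hcoc
              have heq : (extL Q b (v, l), extL Q b (v, l')) =
                  (extR Q a (v, l), extR Q a (v, l')) := by
                by_contra hne
                have := DFunLike.congr_fun hcoc ⟨_, hL' b hb⟩
                rw [Finsupp.sub_apply, Finsupp.smul_apply, Finsupp.single_eq_same,
                  Finsupp.single_eq_of_ne] at this
                · simp at this
                · intro h
                  exact hne (congrArg Subtype.val h)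
              have hs : (1 : k) - (-1) ^ (m' + 2) = 0 := by
                have := DFunLike.congr_fun hcoc ⟨_, hL' b hb⟩
                rw [Finsupp.sub_apply, Finsupp.smul_apply, Finsupp.single_eq_same,
                  show (⟨_, hL' b hb⟩ : GB Q R (m' + 2 + 1)) = ⟨_, (hR' a ha).2⟩ from
                    Subtype.ext heq, Finsupp.single_eq_same] at this
                simpa using this
              refine ⟨sign_even.1 hs, ?_⟩
              simp only [extL, extR, Prod.mk.injEq] at heq
              obtain ⟨⟨hv, heq1⟩, -, heq2⟩ := heq
              obtain ⟨hr1, rfl⟩ := append_eq_cons heq1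
              obtain ⟨hr2, -⟩ := append_eq_cons heq2
              have hl' : l' = [] := by
                by_contra hne
                apply hlast
                rw [hr1, hr2, hlen, List.getLast?_replicate, List.getLast?_replicate]
                simp [hne]
              refine ⟨b, ?_, ?_⟩
              · rw [(hR' b ha).1, hv]
              · change ((v, l), (v, l')) = _
                rw [hl', hv, show m' + 2 = l.length from hlen.symm, ← hr1]
            · push Not at h2
              rw [hTL, TR_zero (x := ⟨_, hu⟩) (fun a ha => h2 a ((hRu a).1 ha).1)] at hcoc
              simp at hcoc
          · push Not at h1
            by_cases h2 : ∃ a, (a, e) ∈ R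
            · obtain ⟨a, ha⟩ := h2
              rw [TR_single (x := ⟨_, hu⟩) hg a (hR' a ha),
                TL_zero (x := ⟨_, hu⟩) (fun b hb => h1 b ((hLu b).1 hb).1)] at hcoc
              simp at hcoc
            · push Not at h2
              exact absurd (gmax_or hu.1 hc he h1 h2) hmax
  · rintro (⟨hpar, b, hb, hub⟩ | ⟨hpar, C, b, hC, hCb, hub⟩ | ⟨hmax, hhead, hlast⟩)
    · simp only [Prod.mk.injEq] at hub
      obtain ⟨⟨rfl, rfl⟩, -, rfl⟩ := hub
      obtain rfl : b = c := by simpa [List.getLast?_replicate] using hc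
      obtain rfl : b = e := by simpa [List.head?_replicate] using he
      refine ⟨?_, not_cob_of_ne hg (by simp [List.head?_replicate])
        (by simp [List.getLast?_replicate])⟩
      have hbb : (b, b) ∈ R := by
        have := hu.1.2
        simp only [List.replicate_succ] at this
        exact (List.isChain_cons.1 this).1 b rfl
      have hL := (hLu b).2 ⟨hbb, by simp⟩
      have hR := (hRu b).2 ⟨hbb, by simp⟩
      rw [dB_eq, TL_single (x := ⟨_, hu⟩) hg b hL, TR_single (x := ⟨_, hu⟩) hg b hR]
      have : (⟨_, hL⟩ : GB Q R (m' + 2 + 1)) = ⟨_, hR.2⟩ := by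
        apply Subtype.ext
        simp only [extL, extR, List.nil_append, Prod.mk.injEq, and_true, true_and]
        rw [← List.replicate_succ', List.replicate_succ]
      rw [this]
      have hs := sign_even.2 hpar
      rw [← one_smul k (Finsupp.single _ (1 : k)), smul_smul, ← sub_smul]
      simp only [mul_one]
      rw [hs, zero_smul]
    · simp only [Prod.mk.injEq] at hub
      obtain ⟨⟨rfl, rfl⟩, hv, rfl⟩ := hub
      have hCL := CL_of_complete hC
      obtain rfl : b = c := by simpa using hc
      obtain rfl : b = e := by
        rw [List.head?_append, hCb] at he
        simpa using he
      constructor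
      · rw [dB_eq, TL_zero, TR_zero]
        · simp
        · intro a ha
          have := (hRu a).1 ha
          exact this.2 b rfl this.1
        · intro a ha
          have := (hLu a).1 ha
          exact this.2 b rfl this.1
      · apply not_cob_cyc hg (m := m')
        · rw [sign_even]
          rcases hpar with h | h
          · left
            rcases Nat.even_or_odd (m' + 1) with h' | h'
            · exact h'
            · exact absurd h (by simpa [parity_simps] using h')
          · exact Or.inr h
        · exact ⟨C.2, b, hCL, hCb, rfl, rfl⟩
    · refine ⟨?_, not_cob_of_ne hg hhead hlast⟩
      rw [dB_eq, TL_zero, TR_zero]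
      · simp
      · intro a ha
        have := hmax.2 _ ha.2.1 ⟨[a], [], by simp [extR]⟩
        simp [extR] at this
      · intro a ha
        have := hmax.2 _ ha.1 ⟨[], [a], by simp [extL]⟩
        simp [extL] at this


end GentleTT
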